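/- Let A_ref ∈ ℝ^{n×n}, B ∈ ℝ^{n×m}, let Q, P ∈ ℝ^{n×n} be symmetric positive definite with A_refᵀ·P + P·A_ref = −Q, let Ψ : [T1,∞) → ℝ^p be continuous, κ > 0, γ0 > 1/(2κ), β_max ≥ 0. Suppose e : [T1,∞) → ℝ^n is differentiable and Θ̃ : [T1,∞) → ℝ^{p×m} is a (possibly discontinuous) function with e'(t) = A_ref·e(t) + B·(Θ̃(t)ᵀ·Ψ(t) − κ·Bᵀ·P·e(t)·(Ψ(t)ᵀΨ(t))) and ‖Θ̃(t)‖_F ≤ β_max·e^{−γ0(t−T1)} for all t ≥ T1. Then L(t) = e(t)ᵀ·P·e(t) + (β_max²/2)·e^{−2γ0(t−T1)} satisfies L(t) ≤ e^{−c(t−T1)}·L(T1) for all t ≥ T1, where c = min{λ_min(Q)/λ_max(P), 2γ0 − 1/κ} > 0; in particular ‖e(t)‖ converges to 0 exponentially. -/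

import Mathlib

open Matrix

/-- Frobenius norm of a real matrix. -/
noncomputable def frobNorm {p m : ℕ} (M : Matrix (Fin p) (Fin m) ℝ) : ℝ :=
  Real.sqrt (∑ i, ∑ j, (M i j) ^ 2)

theorem ray_eq {n : ℕ} {A : Matrix (Fin n) (Fin n) ℝ} (hA : A.IsHermitian) (x : Fin n → ℝ) :
    ∃ y : Fin n → ℝ, y ⬝ᵥ y = x ⬝ᵥ x ∧ x ⬝ᵥ A *ᵥ x = ∑ i, hA.eigenvalues i * (y i) ^ 2 := by
  set U : Matrix (Fin n) (Fin n) ℝ := (hA.eigenvectorUnitary : Matrix (Fin n) (Fin n) ℝ) with hU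
  have h1 : U * Uᵀ = 1 := by
    have := Unitary.coe_mul_star_self hA.eigenvectorUnitary
    simpa [star_eq_conjTranspose, conjTranspose_eq_transpose_of_trivial] using this
  have h2 : A = U * diagonal hA.eigenvalues * Uᵀ := by
    have := hA.spectral_theorem
    rw [Unitary.conjStarAlgAut_apply] at this
    simpa [star_eq_conjTranspose, conjTranspose_eq_transpose_of_trivial, Function.comp_def] using this
  have key : ∀ z : Fin n → ℝ, x ⬝ᵥ U *ᵥ z = (Uᵀ *ᵥ x) ⬝ᵥ z := by
    intro z
    rw [dotProduct_mulVec, mulVec_transpose]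
  refine ⟨Uᵀ *ᵥ x, ?_, ?_⟩
  · rw [← key, mulVec_mulVec, h1, one_mulVec]
  · have : A *ᵥ x = U *ᵥ (diagonal hA.eigenvalues *ᵥ (Uᵀ *ᵥ x)) := by
      rw [mulVec_mulVec, mulVec_mulVec, ← h2]
    rw [this, key]
    simp only [dotProduct, mulVec_diagonal]
    exact Finset.sum_congr rfl fun i _ => by ring

theorem ray_lb {n : ℕ} {A : Matrix (Fin n) (Fin n) ℝ} (hA : A.IsHermitian) (x : Fin n → ℝ) :
    (⨅ i, hA.eigenvalues i) * (x ⬝ᵥ x) ≤ x ⬝ᵥ A *ᵥ x := by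
  obtain ⟨y, h1, h2⟩ := ray_eq hA x
  rw [h2, ← h1, dotProduct, Finset.mul_sum]
  refine Finset.sum_le_sum fun i _ => ?_
  rw [← pow_two]
  exact mul_le_mul_of_nonneg_right (ciInf_le (Set.finite_range _).bddBelow i) (sq_nonneg _)

theorem ray_ub {n : ℕ} {A : Matrix (Fin n) (Fin n) ℝ} (hA : A.IsHermitian) (x : Fin n → ℝ) :
    x ⬝ᵥ A *ᵥ x ≤ (⨆ i, hA.eigenvalues i) * (x ⬝ᵥ x) := by
  obtain ⟨y, h1, h2⟩ := ray_eq hA x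
  rw [h2, ← h1, dotProduct, Finset.mul_sum]
  refine Finset.sum_le_sum fun i _ => ?_
  rw [← pow_two]
  exact mul_le_mul_of_nonneg_right (le_ciSup (Set.finite_range _).bddAbove i) (sq_nonneg _)

theorem quad_deriv {n : ℕ} (P : Matrix (Fin n) (Fin n) ℝ) (e : ℝ → Fin n → ℝ) (v : Fin n → ℝ)
    (t : ℝ) (h : HasDerivAt e v t) :
    HasDerivAt (fun s => e s ⬝ᵥ P *ᵥ e s) (v ⬝ᵥ P *ᵥ e t + e t ⬝ᵥ P *ᵥ v) t := by
  have h' := hasDerivAt_pi.1 h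
  have hP : ∀ i, HasDerivAt (fun s => (P *ᵥ e s) i) ((P *ᵥ v) i) t := by
    intro i
    simp only [mulVec, dotProduct]
    exact HasDerivAt.fun_sum fun j _ => (h' j).const_mul _
  have := HasDerivAt.fun_sum (u := Finset.univ) fun i _ => (h' i).mul (hP i)
  simp only [dotProduct, ← Finset.sum_add_distrib]
  exact this

theorem cross_bound {p m : ℕ} (M : Matrix (Fin p) (Fin m) ℝ) (ψ : Fin p → ℝ) (w : Fin m → ℝ)
    (κ b : ℝ) (hκ : 0 < κ) (hb : frobNorm M ≤ b) :
    2 * (w ⬝ᵥ Mᵀ *ᵥ ψ) ≤ 2 * κ * (ψ ⬝ᵥ ψ) * (w ⬝ᵥ w) + b ^ 2 / (2 * κ) := by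
  have h0 : (∑ i, ∑ j, (M i j) ^ 2) ≤ b ^ 2 := by
    have hnn : 0 ≤ ∑ i, ∑ j, (M i j) ^ 2 :=
      Finset.sum_nonneg fun i _ => Finset.sum_nonneg fun j _ => sq_nonneg _
    rw [← Real.sq_sqrt hnn]
    exact pow_le_pow_left₀ (Real.sqrt_nonneg _) hb 2
  have h1 : 2 * (w ⬝ᵥ Mᵀ *ᵥ ψ) = ∑ i, ∑ j, 2 * (M i j * (ψ i * w j)) := by
    rw [Finset.sum_comm]
    simp only [dotProduct, mulVec, transpose_apply, Finset.mul_sum]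
    exact Finset.sum_congr rfl fun i _ => Finset.sum_congr rfl fun j _ => by ring
  have h2 : 2 * κ * (ψ ⬝ᵥ ψ) * (w ⬝ᵥ w) = ∑ i, ∑ j, 2 * κ * (ψ i * w j) ^ 2 := by
    rw [mul_assoc, dotProduct, dotProduct, Finset.sum_mul_sum]
    simp only [Finset.mul_sum]
    exact Finset.sum_congr rfl fun i _ => Finset.sum_congr rfl fun j _ => by ring
  have h3 : 2 * (w ⬝ᵥ Mᵀ *ᵥ ψ) ≤
      2 * κ * (ψ ⬝ᵥ ψ) * (w ⬝ᵥ w) + (∑ i, ∑ j, (M i j) ^ 2) / (2 * κ) := by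
    rw [h1, h2, Finset.sum_div, ← Finset.sum_add_distrib]
    refine Finset.sum_le_sum fun i _ => ?_
    rw [Finset.sum_div, ← Finset.sum_add_distrib]
    refine Finset.sum_le_sum fun j _ => ?_
    have : 2 * κ * (ψ i * w j) ^ 2 + M i j ^ 2 / (2 * κ) - 2 * (M i j * (ψ i * w j))
        = (2 * κ * (ψ i * w j) - M i j) ^ 2 / (2 * κ) := by
      field_simp
      ring
    have h4 : 0 ≤ (2 * κ * (ψ i * w j) - M i j) ^ 2 / (2 * κ) := by positivity
    linarith
  have h5 : (∑ i, ∑ j, (M i j) ^ 2) / (2 * κ) ≤ b ^ 2 / (2 * κ) := by gcongr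
  linarith

theorem sup_sq_le {n : ℕ} (x : Fin n → ℝ) : ‖x‖ ≤ Real.sqrt (x ⬝ᵥ x) := by
  refine (pi_norm_le_iff_of_nonneg (Real.sqrt_nonneg _)).2 fun i => ?_
  rw [Real.norm_eq_abs]
  refine Real.abs_le_sqrt ?_
  rw [dotProduct, pow_two]
  exact Finset.single_le_sum (f := fun i => x i * x i) (fun i _ => mul_self_nonneg _)
    (Finset.mem_univ i)

/-- Step 2 of the proof of Theorem 2: if
`ė = A_ref e + B(Θ̃ᵀ Ψ − κ BᵀP e ΨᵀΨ)` with `‖Θ̃(t)‖_F ≤ β_max e^{−γ0(t−T1)}`,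
`A_refᵀP + P A_ref = −Q` and `γ0 > 1/(2κ)`, then
`L(t) = eᵀPe + (β_max²/2) e^{−2γ0(t−T1)}` satisfies
`L(t) ≤ e^{−c(t−T1)} L(T1)` with `c = min{λ_min(Q)/λ_max(P), 2γ0 − 1/κ} > 0`;
in particular `‖e‖ → 0` exponentially. -/
theorem lyapunov_decay_with_envelope
    (n m p : ℕ) (hn : 0 < n) (T1 κ γ0 βmax : ℝ)
    (hκ : 0 < κ) (hγ0 : 1 / (2 * κ) < γ0) (hβ : 0 ≤ βmax)
    (Aref : Matrix (Fin n) (Fin n) ℝ) (B : Matrix (Fin n) (Fin m) ℝ)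
    (Q P : Matrix (Fin n) (Fin n) ℝ)
    (hQsymm : Q.IsHermitian) (hPsymm : P.IsHermitian)
    (hQpd : Q.PosDef) (hPpd : P.PosDef)
    (hLyap : Arefᵀ * P + P * Aref = -Q)
    (Ψ : ℝ → Fin p → ℝ) (hΨc : ContinuousOn Ψ (Set.Ici T1))
    (e : ℝ → Fin n → ℝ) (Θt : ℝ → Matrix (Fin p) (Fin m) ℝ)
    (he : ∀ t, T1 ≤ t →
      HasDerivAt e (Aref.mulVec (e t) +
        B.mulVec ((Θt t)ᵀ.mulVec (Ψ t) -
          (κ * (Ψ t ⬝ᵥ Ψ t)) • (Bᵀ.mulVec (P.mulVec (e t))))) t)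
    (hΘbound : ∀ t, T1 ≤ t →
      frobNorm (Θt t) ≤ βmax * Real.exp (-γ0 * (t - T1))) :
    ∀ c : ℝ,
      c = min ((⨅ i, hQsymm.eigenvalues i) / (⨆ i, hPsymm.eigenvalues i))
        (2 * γ0 - 1 / κ) →
      0 < c ∧
      (∀ t, T1 ≤ t →
        e t ⬝ᵥ P.mulVec (e t) +
            (βmax ^ 2 / 2) * Real.exp (-2 * γ0 * (t - T1)) ≤
          Real.exp (-c * (t - T1)) *
            (e T1 ⬝ᵥ P.mulVec (e T1) + βmax ^ 2 / 2)) ∧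
      (∃ C, 0 ≤ C ∧ ∀ t, T1 ≤ t →
        ‖e t‖ ≤ C * Real.exp (-(c / 2) * (t - T1))) := by
  intro c hc
  haveI : Nonempty (Fin n) := ⟨⟨0, hn⟩⟩
  set lQ := ⨅ i, hQsymm.eigenvalues i with hlQ
  set lP := ⨅ i, hPsymm.eigenvalues i with hlP
  set LP := ⨆ i, hPsymm.eigenvalues i with hLP
  have hlQpos : 0 < lQ := by
    obtain ⟨i, hi⟩ := exists_eq_ciInf_of_finite (f := hQsymm.eigenvalues)
    rw [hlQ, ← hi]; exact hQpd.eigenvalues_pos i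
  have hlPpos : 0 < lP := by
    obtain ⟨i, hi⟩ := exists_eq_ciInf_of_finite (f := hPsymm.eigenvalues)
    rw [hlP, ← hi]; exact hPpd.eigenvalues_pos i
  have hLPpos : 0 < LP := by
    obtain ⟨i, hi⟩ := exists_eq_ciSup_of_finite (f := hPsymm.eigenvalues)
    rw [hLP, ← hi]; exact hPpd.eigenvalues_pos i
  have hg : 0 < 2 * γ0 - 1 / κ := by
    have : 1 / (2 * κ) = 1 / κ / 2 := by field_simp
    linarith
  have hcpos : 0 < c := by rw [hc]; exact lt_min (div_pos hlQpos hLPpos) hg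
  have hc1 : c ≤ lQ / LP := hc ▸ min_le_left _ _
  have hc2 : c ≤ 2 * γ0 - 1 / κ := hc ▸ min_le_right _ _
  have hPT : Pᵀ = P := by
    rw [← conjTranspose_eq_transpose_of_trivial]; exact hPsymm
  have hsym : ∀ x y : Fin n → ℝ, x ⬝ᵥ P *ᵥ y = y ⬝ᵥ P *ᵥ x := by
    intro x y
    rw [dotProduct_mulVec, ← mulVec_transpose, hPT, dotProduct_comm]
  have hPnn : ∀ x : Fin n → ℝ, 0 ≤ x ⬝ᵥ x := fun x =>
    Finset.sum_nonneg fun i _ => mul_self_nonneg _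
  have hQP : ∀ x : Fin n → ℝ, c * (x ⬝ᵥ P *ᵥ x) ≤ x ⬝ᵥ Q *ᵥ x := by
    intro x
    have h1 := ray_lb hQsymm x
    have h2 := ray_ub hPsymm x
    calc c * (x ⬝ᵥ P *ᵥ x) ≤ c * (LP * (x ⬝ᵥ x)) := by gcongr
      _ = (c * LP) * (x ⬝ᵥ x) := by ring
      _ ≤ lQ * (x ⬝ᵥ x) := by
        refine mul_le_mul_of_nonneg_right ?_ (hPnn x)
        exact (le_div_iff₀ hLPpos).1 hc1
      _ ≤ _ := h1
  have hVder : ∀ t, T1 ≤ t → ∃ d, HasDerivAt (fun s => e s ⬝ᵥ P *ᵥ e s) d t ∧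
      d ≤ - (e t ⬝ᵥ Q *ᵥ e t) + (βmax * Real.exp (-γ0 * (t - T1))) ^ 2 / (2 * κ) := by
    intro t ht
    refine ⟨_, quad_deriv P e _ t (he t ht), ?_⟩
    have hcb := cross_bound (Θt t) (Ψ t) (Bᵀ *ᵥ (P *ᵥ e t)) κ _ hκ (hΘbound t ht)
    have hA : 2 * (e t ⬝ᵥ P *ᵥ (Aref *ᵥ e t)) = -(e t ⬝ᵥ Q *ᵥ e t) := by
      have h1 : e t ⬝ᵥ (Arefᵀ * P + P * Aref) *ᵥ e t = e t ⬝ᵥ (-Q) *ᵥ e t := by rw [hLyap]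
      rw [add_mulVec, dotProduct_add, neg_mulVec, dotProduct_neg, ← mulVec_mulVec,
        ← mulVec_mulVec] at h1
      have h2 : e t ⬝ᵥ Arefᵀ *ᵥ (P *ᵥ e t) = e t ⬝ᵥ P *ᵥ (Aref *ᵥ e t) := by
        rw [dotProduct_mulVec, vecMul_transpose, hsym]
      linarith
    have hB : ∀ z, e t ⬝ᵥ P *ᵥ (B *ᵥ z) = (Bᵀ *ᵥ (P *ᵥ e t)) ⬝ᵥ z := by
      intro z
      rw [hsym, dotProduct_comm, dotProduct_mulVec, mulVec_transpose]
    rw [hsym _ (e t), mulVec_add, dotProduct_add, hB, dotProduct_sub, dotProduct_smul, smul_eq_mul]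
    linarith
  have hE : ∀ a t : ℝ, HasDerivAt (fun s => Real.exp (a * (s - T1)))
      (a * Real.exp (a * (t - T1))) t := by
    intro a t
    have h := (((hasDerivAt_id t).sub_const T1).const_mul a).exp
    simp only [id, mul_one] at h
    rw [mul_comm a (Real.exp _)]
    exact h
  have hmain : ∀ t, T1 ≤ t →
        e t ⬝ᵥ P.mulVec (e t) +
            (βmax ^ 2 / 2) * Real.exp (-2 * γ0 * (t - T1)) ≤
          Real.exp (-c * (t - T1)) *
            (e T1 ⬝ᵥ P.mulVec (e T1) + βmax ^ 2 / 2) := by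
    set g : ℝ → ℝ := fun t => Real.exp (c * (t - T1)) * (e t ⬝ᵥ P.mulVec (e t) +
            (βmax ^ 2 / 2) * Real.exp (-2 * γ0 * (t - T1))) with hgdef
    have hgd : ∀ t, T1 ≤ t → ∃ d, HasDerivAt g d t ∧ d ≤ 0 := by
      intro t ht
      obtain ⟨d, hd, hdle⟩ := hVder t ht
      refine ⟨_, (hE c t).mul (hd.add ((hE (-2 * γ0) t).const_mul (βmax ^ 2 / 2))), ?_⟩
      have hsq : (βmax * Real.exp (-γ0 * (t - T1))) ^ 2
          = βmax ^ 2 * Real.exp (-2 * γ0 * (t - T1)) := by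
        rw [mul_pow, ← Real.exp_nat_mul]
        congr 2
        push_cast; ring
      rw [hsq] at hdle
      have hq := hQP (e t)
      set E := Real.exp (-2 * γ0 * (t - T1)) with hEdef
      have hEpos : 0 < E := Real.exp_pos _
      have h3 : βmax ^ 2 * E / (2 * κ) = (1 / κ) * (βmax ^ 2 / 2 * E) := by
        field_simp
      have h4 : c * (βmax ^ 2 / 2 * E) ≤ (2 * γ0 - 1 / κ) * (βmax ^ 2 / 2 * E) := by gcongr
      have h5 : c * (e t ⬝ᵥ P *ᵥ e t + βmax ^ 2 / 2 * E) +
          (d + βmax ^ 2 / 2 * (-2 * γ0 * E)) ≤ 0 := by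
        rw [h3] at hdle
        linarith
      have h6 := mul_nonpos_of_nonneg_of_nonpos (Real.exp_pos (c * (t - T1))).le h5
      refine le_trans (le_of_eq ?_) h6
      ring
    have hanti : AntitoneOn g (Set.Ici T1) := by
      refine antitoneOn_of_deriv_nonpos (convex_Ici T1) ?_ ?_ ?_
      · intro t ht
        obtain ⟨d, hd, _⟩ := hgd t ht
        exact hd.continuousAt.continuousWithinAt
      · intro t ht
        obtain ⟨d, hd, _⟩ := hgd t (interior_subset ht)
        exact hd.differentiableAt.differentiableWithinAt
      · intro t ht
        obtain ⟨d, hd, hle⟩ := hgd t (interior_subset ht)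
        rw [hd.deriv]; exact hle
    intro t ht
    have h := hanti (Set.mem_Ici.2 le_rfl) (Set.mem_Ici.2 ht) ht
    simp only [hgdef, sub_self, mul_zero, Real.exp_zero, one_mul, mul_one] at h
    have h7 := mul_le_mul_of_nonneg_left h (Real.exp_pos (-c * (t - T1))).le
    rw [← mul_assoc, ← Real.exp_add] at h7
    simpa using h7
  refine ⟨hcpos, hmain, ?_⟩
  set L0 := e T1 ⬝ᵥ P.mulVec (e T1) + βmax ^ 2 / 2 with hL0
  refine ⟨Real.sqrt (L0 / lP), Real.sqrt_nonneg _, fun t ht => ?_⟩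
  have h1 := hmain t ht
  have h2 := ray_lb hPsymm (e t)
  have h3 : 0 ≤ βmax ^ 2 / 2 * Real.exp (-2 * γ0 * (t - T1)) := by positivity
  have h4 : e t ⬝ᵥ e t ≤ L0 / lP * Real.exp (-c * (t - T1)) := by
    rw [div_mul_eq_mul_div, le_div_iff₀ hlPpos]
    linarith
  have h5 : Real.exp (-c * (t - T1)) = Real.exp (-(c / 2) * (t - T1)) ^ 2 := by
    rw [← Real.exp_nat_mul]
    congr 1
    push_cast; ring
  refine (sup_sq_le (e t)).trans ((Real.sqrt_le_sqrt h4).trans (le_of_eq ?_))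
  rw [h5, Real.sqrt_mul' _ (sq_nonneg _), Real.sqrt_sq (Real.exp_pos _).le]
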